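/- Let k ≥ 1 be an integer, α := 2^{−k}, and 0 < β ≤ 1/2. Then: liminf_{n→∞} Γ_S^(n)(2^{n−k}, 2⌊βn/2⌋+1) ≥ ((1−β)/2)^k; liminf_{n→∞} Γ_B^(n)(2^{n−k}, 2⌊βn/2⌋) ≥ ((1−β)/2)^k; and liminf_{n→∞} Γ_S^(n)(2^{n−k}, 2⌊βn/2⌋) ≥ (1/2)·((1−β)/2)^{k−1}. -/

import Mathlib

open Finset

noncomputable section

/-- The Hamming ball of radius `r` around the all-ones vector in `{-1,1}^n`
(vertices modeled as `Fin n → ℤˣ`, where `ℤˣ = {1, -1}`). -/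
def hBall (n r : ℕ) : Finset (Fin n → ℤˣ) :=
  Finset.univ.filter fun z => hammingDist z 1 ≤ r

/-- The Hamming sphere of radius `r` around the all-ones vector. -/
def hSphere (n r : ℕ) : Finset (Fin n → ℤˣ) :=
  Finset.univ.filter fun z => hammingDist z 1 = r

/-- Ball-noise stability `E[f(X) f(X∘Z)]`, `X` uniform on the cube, `Z` uniform on `B_r`. -/
def BStab (n r : ℕ) (f : (Fin n → ℤˣ) → ℝ) : ℝ :=
  (∑ x : Fin n → ℤˣ, ∑ z ∈ hBall n r, f x * f (x * z)) / (2 ^ n * (hBall n r).card)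

/-- Sphere-noise stability `E[f(X) f(X∘Z)]`, `X` uniform on the cube, `Z` uniform on `S_r`. -/
def SStab (n r : ℕ) (f : (Fin n → ℤˣ) → ℝ) : ℝ :=
  (∑ x : Fin n → ℤˣ, ∑ z ∈ hSphere n r, f x * f (x * z)) / (2 ^ n * (hSphere n r).card)

/-- i.i.d.-noise stability `E[f(X) f(X∘Z)]`, `Z` with i.i.d. coordinates equal to `-1`
with probability `β` and `1` with probability `1-β`. -/
def Stab (n : ℕ) (β : ℝ) (f : (Fin n → ℤˣ) → ℝ) : ℝ :=
  (∑ x : Fin n → ℤˣ, ∑ z : Fin n → ℤˣ,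
      (∏ i, if z i = 1 then 1 - β else β) * (f x * f (x * z))) / 2 ^ n

/-- Indicator function of a set `A` of vertices. -/
def indic (n : ℕ) (A : Finset (Fin n → ℤˣ)) : (Fin n → ℤˣ) → ℝ :=
  fun x => if x ∈ A then 1 else 0

/-- `Γ_B^(n)(M,r)`: maximal ball-noise stability over Boolean functions with exactly `M` ones. -/
def GammaB (n M r : ℕ) : ℝ :=
  sSup {y | ∃ A : Finset (Fin n → ℤˣ), A.card = M ∧ y = BStab n r (indic n A)}

/-- `Γ_S^(n)(M,r)`: maximal sphere-noise stability over Boolean functions with exactly `M` ones. -/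
def GammaS (n M r : ℕ) : ℝ :=
  sSup {y | ∃ A : Finset (Fin n → ℤˣ), A.card = M ∧ y = SStab n r (indic n A)}

/-- `Γ_IID^(n)(M,β)`: maximal i.i.d.-noise stability over Boolean functions with exactly `M` ones. -/
def GammaIID (n M : ℕ) (β : ℝ) : ℝ :=
  sSup {y | ∃ A : Finset (Fin n → ℤˣ), A.card = M ∧ y = Stab n β (indic n A)}

/-- `Γ_IID(α,β) := sup_n Γ_IID^(n)(⌊α·2^n⌋, β)` (equivalently the limit, by monotonicity). -/
def GammaIIDlim (α β : ℝ) : ℝ := ⨆ n : ℕ, GammaIID n ⌊α * 2 ^ n⌋₊ β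

/-- `C(n, ≤ r) = Σ_{i=0}^r C(n,i)`. -/
def ballBinom (n r : ℕ) : ℕ := ∑ i ∈ Finset.range (r + 1), n.choose i

open Filter

/-- The vertex of the cube whose set of `-1` coordinates is `s`. -/
def signVec {n : ℕ} (s : Finset (Fin n)) : Fin n → ℤˣ := fun i => if i ∈ s then -1 else 1

/-- The subcube of vertices whose first `j` coordinates are `1`. -/
def subcube (n j : ℕ) : Finset (Fin n → ℤˣ) :=
  Finset.univ.filter fun x => ∀ i : Fin n, i.val < j → x i = 1

/-- The vertices of `subcube n j` with an even number of `-1` coordinates. -/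
def evenSubcube (n j : ℕ) : Finset (Fin n → ℤˣ) :=
  (subcube n j).filter fun x => ∏ i, x i = 1

lemma signVec_injective {n : ℕ} : Function.Injective (signVec (n := n)) := by
  intro s t h
  ext i
  have hi := congrFun h i
  by_cases h1 : i ∈ s <;> by_cases h2 : i ∈ t <;> simp_all [signVec]

lemma signVec_filter_ne_one {n : ℕ} (x : Fin n → ℤˣ) :
    signVec (Finset.univ.filter fun i => x i ≠ 1) = x := by
  funext i
  rcases Int.units_eq_one_or (x i) with h | h <;> simp [signVec, h]

lemma hammingDist_signVec {n : ℕ} (s : Finset (Fin n)) : hammingDist (signVec s) 1 = #s := by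
  unfold hammingDist
  congr 1
  ext i
  by_cases h : i ∈ s <;> simp [signVec, h]

lemma prod_signVec {n : ℕ} (s : Finset (Fin n)) : ∏ i, signVec s i = (-1) ^ #s := by
  simp [signVec]

lemma signVec_mem_subcube {n j : ℕ} (s : Finset (Fin n)) :
    signVec s ∈ subcube n j ↔ s ⊆ Finset.univ.filter fun i : Fin n => j ≤ i.val := by
  simp only [subcube, Finset.mem_filter, Finset.mem_univ, true_and, Finset.subset_iff]
  refine forall_congr' fun i => ?_
  by_cases h : i ∈ s <;> simp [signVec, h]

lemma card_filter_le_val (n j : ℕ) : #(Finset.univ.filter fun i : Fin n => j ≤ i.val) = n - j := by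
  have h := Fin.card_filter_val_lt (n := n) (m := j)
  have h2 := Finset.card_filter_add_card_filter_not (s := (Finset.univ : Finset (Fin n)))
    (fun i => i.val < j)
  simp only [not_lt, Finset.card_univ, Fintype.card_fin] at h2
  omega

lemma card_subcube (n j : ℕ) : #(subcube n j) = 2 ^ (n - j) := by
  have h : subcube n j =
      (Finset.univ.filter fun i : Fin n => j ≤ i.val).powerset.image signVec := by
    ext x
    rw [← signVec_filter_ne_one x, signVec_mem_subcube, signVec_injective.mem_finset_image,
      Finset.mem_powerset]
  rw [h, Finset.card_image_of_injective _ signVec_injective, Finset.card_powerset,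
    card_filter_le_val]

lemma card_hSphere_inter_subcube (n j r : ℕ) :
    #((hSphere n r).filter (· ∈ subcube n j)) = (n - j).choose r := by
  have h : (hSphere n r).filter (· ∈ subcube n j) =
      ((Finset.univ.filter fun i : Fin n => j ≤ i.val).powersetCard r).image signVec := by
    ext x
    rw [← signVec_filter_ne_one x, signVec_injective.mem_finset_image, Finset.mem_filter,
      signVec_mem_subcube, Finset.mem_powersetCard, hSphere, Finset.mem_filter,
      hammingDist_signVec]
    simp [and_comm]
  rw [h, Finset.card_image_of_injective _ signVec_injective, Finset.card_powersetCard,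
    card_filter_le_val]

lemma subcube_zero (n : ℕ) : subcube n 0 = Finset.univ := by simp [subcube]

lemma card_hSphere (n r : ℕ) : #(hSphere n r) = n.choose r := by
  simpa [subcube_zero] using card_hSphere_inter_subcube n 0 r

lemma card_hBall_inter_subcube (n j r : ℕ) :
    #((hBall n r).filter (· ∈ subcube n j)) = ballBinom (n - j) r := by
  rw [ballBinom, Finset.card_eq_sum_card_fiberwise (f := fun z => hammingDist z 1)
    (t := Finset.range (r + 1))]
  · refine Finset.sum_congr rfl fun s hs => ?_
    rw [← card_hSphere_inter_subcube]
    congr 1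
    ext z
    have hs' := Finset.mem_range.1 hs
    simp only [hBall, hSphere, Finset.mem_filter, Finset.mem_univ, true_and]
    constructor
    · rintro ⟨⟨-, h⟩, h'⟩
      exact ⟨h', h⟩
    · rintro ⟨h', h⟩
      exact ⟨⟨by omega, h⟩, h'⟩
  · intro z hz
    simp only [hBall, Finset.coe_filter, Finset.mem_filter, Finset.mem_univ, true_and,
      Set.mem_ofPred_eq] at hz
    simp only [Finset.coe_range, Set.mem_Iio]
    omega

lemma card_hBall (n r : ℕ) : #(hBall n r) = ballBinom n r := by
  simpa [subcube_zero] using card_hBall_inter_subcube n 0 r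

lemma mul_mem_subcube_iff {n j : ℕ} {x z : Fin n → ℤˣ} (hx : x ∈ subcube n j) :
    x * z ∈ subcube n j ↔ z ∈ subcube n j := by
  simp only [subcube, Finset.mem_filter, Finset.mem_univ, true_and] at hx ⊢
  refine forall₂_congr fun i hi => ?_
  simp [hx i hi]

lemma mul_mem_evenSubcube_iff {n j : ℕ} {x z : Fin n → ℤˣ} (hx : x ∈ evenSubcube n j) :
    x * z ∈ evenSubcube n j ↔ z ∈ evenSubcube n j := by
  rw [evenSubcube, Finset.mem_filter] at hx
  simp [evenSubcube, mul_mem_subcube_iff hx.1, Finset.prod_mul_distrib, hx.2]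

lemma card_evenSubcube {n j : ℕ} (h : j < n) : #(evenSubcube n j) = 2 ^ (n - (j + 1)) := by
  set c : Fin n → ℤˣ := signVec {⟨j, h⟩}
  have hc : c ∈ subcube n j := by simp [c, signVec_mem_subcube]
  have hcp : ∏ i, c i = -1 := by simp [c, prod_signVec]
  have hcc : ∀ x : Fin n → ℤˣ, c * (c * x) = x := fun x => by
    funext i
    simp [← mul_assoc]
  have hodd : #(evenSubcube n j) = #((subcube n j).filter fun x => ¬ ∏ i, x i = 1) := by
    refine Finset.card_nbij' (fun x => c * x) (fun x => c * x) ?_ ?_ (fun x _ => hcc x)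
      (fun x _ => hcc x)
    · intro x hx
      simp only [evenSubcube, Finset.coe_filter, Set.mem_ofPred_eq] at hx ⊢
      refine ⟨(mul_mem_subcube_iff hc).2 hx.1, ?_⟩
      simp [Finset.prod_mul_distrib, hcp, hx.2]
    · intro x hx
      simp only [evenSubcube, Finset.coe_filter, Set.mem_ofPred_eq] at hx ⊢
      refine ⟨(mul_mem_subcube_iff hc).2 hx.1, ?_⟩
      have := (Int.units_eq_one_or (∏ i, x i)).resolve_left hx.2
      simp [Finset.prod_mul_distrib, hcp, this]
  have hsum := Finset.card_filter_add_card_filter_not (s := subcube n j) fun x => ∏ i, x i = 1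
  rw [← hodd, card_subcube, show n - j = (n - (j + 1)) + 1 by omega, pow_succ] at hsum
  change #(evenSubcube n j) + _ = _ at hsum
  omega

lemma hSphere_inter_evenSubcube {n j r : ℕ} (hr : Even r) :
    (hSphere n r).filter (· ∈ evenSubcube n j) = (hSphere n r).filter (· ∈ subcube n j) := by
  refine Finset.filter_congr fun z hz => ?_
  rw [evenSubcube, Finset.mem_filter, and_iff_left]
  rw [hSphere, Finset.mem_filter, ← signVec_filter_ne_one z, hammingDist_signVec] at hz
  rw [← signVec_filter_ne_one z, prod_signVec, hz.2, hr.neg_one_pow]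

/-- A set closed under multiplication and division by its elements has explicit noise stability,
for noise uniform on any set `T`. -/
lemma sum_indic_mul_indic {n : ℕ} (A T : Finset (Fin n → ℤˣ))
    (hA : ∀ x ∈ A, ∀ z, x * z ∈ A ↔ z ∈ A) :
    ∑ x, ∑ z ∈ T, indic n A x * indic n A (x * z) = (#A : ℝ) * #(T.filter (· ∈ A)) := by
  have h : ∀ x, ∑ z ∈ T, indic n A x * indic n A (x * z) =
      if x ∈ A then (#(T.filter (· ∈ A)) : ℝ) else 0 := by
    intro x
    by_cases hx : x ∈ A
    · simp [indic, hx, hA x hx, Finset.filter_mem_eq_inter]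
    · simp [indic, hx]
  simp [h]

lemma sum_indic_div_le_one {n : ℕ} (A T : Finset (Fin n → ℤˣ)) :
    (∑ x, ∑ z ∈ T, indic n A x * indic n A (x * z)) / (2 ^ n * #T) ≤ 1 := by
  refine div_le_one_of_le₀ ?_ (by positivity)
  calc (∑ x, ∑ z ∈ T, indic n A x * indic n A (x * z))
      ≤ ∑ _x : Fin n → ℤˣ, ∑ _z ∈ T, (1 : ℝ) := by
        refine Finset.sum_le_sum fun x _ => Finset.sum_le_sum fun z _ => ?_
        unfold indic
        split_ifs <;> norm_num
    _ = 2 ^ n * #T := by simp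

lemma GammaS_le_one (n M r : ℕ) : GammaS n M r ≤ 1 := by
  refine Real.sSup_le ?_ zero_le_one
  rintro y ⟨A, -, rfl⟩
  exact sum_indic_div_le_one A _

lemma GammaB_le_one (n M r : ℕ) : GammaB n M r ≤ 1 := by
  refine Real.sSup_le ?_ zero_le_one
  rintro y ⟨A, -, rfl⟩
  exact sum_indic_div_le_one A _

lemma SStab_le_GammaS {n : ℕ} (A : Finset (Fin n → ℤˣ)) (r : ℕ) :
    SStab n r (indic n A) ≤ GammaS n #A r := by
  refine le_csSup ⟨1, ?_⟩ ⟨A, rfl, rfl⟩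
  rintro y ⟨A, -, rfl⟩
  exact sum_indic_div_le_one A _

lemma BStab_le_GammaB {n : ℕ} (A : Finset (Fin n → ℤˣ)) (r : ℕ) :
    BStab n r (indic n A) ≤ GammaB n #A r := by
  refine le_csSup ⟨1, ?_⟩ ⟨A, rfl, rfl⟩
  rintro y ⟨A, -, rfl⟩
  exact sum_indic_div_le_one A _

lemma two_pow_sub_mul_div {n k : ℕ} (hk : k ≤ n) (a b : ℝ) :
    (2 : ℝ) ^ (n - k) * a / (2 ^ n * b) = (1 / 2) ^ k * (a / b) := by
  obtain ⟨m, rfl⟩ := Nat.exists_eq_add_of_le hk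
  rw [Nat.add_sub_cancel_left, pow_add, mul_div_mul_comm, one_div_pow]
  congr 1
  field_simp

lemma le_GammaS_subcube {n k : ℕ} (hk : k ≤ n) (r : ℕ) :
    (1 / 2 : ℝ) ^ k * ((n - k).choose r / n.choose r) ≤ GammaS n (2 ^ (n - k)) r := by
  have h := SStab_le_GammaS (subcube n k) r
  rw [SStab, sum_indic_mul_indic _ _ fun x hx z => mul_mem_subcube_iff hx, card_subcube,
    card_hSphere_inter_subcube, card_hSphere] at h
  push_cast at h
  rwa [two_pow_sub_mul_div hk] at h

lemma le_GammaS_evenSubcube {n j r : ℕ} (hj : j < n) (hr : Even r) :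
    (1 / 2 : ℝ) ^ (j + 1) * ((n - j).choose r / n.choose r) ≤
      GammaS n (2 ^ (n - (j + 1))) r := by
  have h := SStab_le_GammaS (evenSubcube n j) r
  rw [SStab, sum_indic_mul_indic _ _ fun x hx z => mul_mem_evenSubcube_iff hx,
    card_evenSubcube hj, hSphere_inter_evenSubcube hr, card_hSphere_inter_subcube,
    card_hSphere] at h
  push_cast at h
  rwa [two_pow_sub_mul_div hj] at h

/-- The ratio `C(m, s) / C(n, s)` decreases in `s` for `m ≤ n`, in cross-multiplied form. -/
lemma choose_mul_choose_le {m n s r : ℕ} (hmn : m ≤ n) (hsr : s ≤ r) :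
    m.choose r * n.choose s ≤ m.choose s * n.choose r := by
  refine Nat.le_of_mul_le_mul_right ?_ (Nat.choose_pos hsr)
  have h1 := Nat.choose_mul (n := m) hsr
  have h2 := Nat.choose_mul (n := n) hsr
  have h3 : (m - s).choose (r - s) ≤ (n - s).choose (r - s) := Nat.choose_mono _ (by omega)
  calc m.choose r * n.choose s * r.choose s
      = m.choose s * (m - s).choose (r - s) * n.choose s := by rw [← h1]; ring
    _ ≤ m.choose s * (n - s).choose (r - s) * n.choose s := by gcongr
    _ = m.choose s * n.choose r * r.choose s := by rw [mul_assoc _ (n.choose r), h2]; ring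

lemma choose_mul_ballBinom_le {m n : ℕ} (hmn : m ≤ n) (r : ℕ) :
    m.choose r * ballBinom n r ≤ ballBinom m r * n.choose r := by
  rw [ballBinom, ballBinom, Finset.mul_sum, Finset.sum_mul]
  exact Finset.sum_le_sum fun s hs =>
    choose_mul_choose_le hmn (Nat.lt_succ_iff.1 (Finset.mem_range.1 hs))

lemma ballBinom_pos (n r : ℕ) : 0 < ballBinom n r :=
  Finset.sum_pos' (fun _ _ => Nat.zero_le _) ⟨0, by simp⟩

lemma choose_div_choose_le {m n : ℕ} (hmn : m ≤ n) (r : ℕ) :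
    (m.choose r / n.choose r : ℝ) ≤ ballBinom m r / ballBinom n r := by
  have hb : (0 : ℝ) < ballBinom n r := by exact_mod_cast ballBinom_pos n r
  rcases (Nat.zero_le (n.choose r)).eq_or_lt with h | h
  · rw [← h, Nat.cast_zero, div_zero]
    positivity
  · rw [div_le_div_iff₀ (by exact_mod_cast h) hb]
    exact_mod_cast choose_mul_ballBinom_le hmn r

lemma le_GammaB_subcube {n k : ℕ} (hk : k ≤ n) (r : ℕ) :
    (1 / 2 : ℝ) ^ k * ((n - k).choose r / n.choose r) ≤ GammaB n (2 ^ (n - k)) r := by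
  have h := BStab_le_GammaB (subcube n k) r
  rw [BStab, sum_indic_mul_indic _ _ fun x hx z => mul_mem_subcube_iff hx, card_subcube,
    card_hBall_inter_subcube, card_hBall] at h
  push_cast at h
  rw [two_pow_sub_mul_div hk] at h
  exact (mul_le_mul_of_nonneg_left (choose_div_choose_le (Nat.sub_le n k) r)
    (by positivity)).trans h

lemma tendsto_sub_sub_div {r : ℕ → ℕ} {β : ℝ} (hβ : β < 1)
    (hr : Tendsto (fun n => (r n : ℝ) / n) atTop (nhds β)) (j : ℕ) :
    Tendsto (fun n => ((n - j - r n : ℕ) : ℝ) / (n - j : ℕ)) atTop (nhds (1 - β)) := by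
  have hj : Tendsto (fun n : ℕ => (j : ℝ) / n) atTop (nhds 0) :=
    tendsto_const_div_atTop_nhds_zero_nat (j : ℝ)
  have hlim : Tendsto (fun n : ℕ => (1 - (j : ℝ) / n - r n / n) / (1 - (j : ℝ) / n)) atTop
      (nhds (1 - β)) := by
    have := ((hj.const_sub 1).sub hr).div (hj.const_sub 1) (by norm_num)
    simpa [Pi.div_def] using this
  have hlt : ∀ᶠ n : ℕ in atTop, (j : ℝ) / n + r n / n < 1 :=
    (hj.add hr).eventually_lt_const (by simpa using hβ)
  refine hlim.congr' ?_
  filter_upwards [hlt, eventually_gt_atTop j] with n hn hnj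
  have hn0 : (0 : ℝ) < n := by exact_mod_cast (Nat.zero_le j).trans_lt hnj
  rw [← add_div, div_lt_one hn0] at hn
  have hle : j + r n ≤ n := by exact_mod_cast hn.le
  rw [Nat.sub_sub, Nat.cast_sub hle, Nat.cast_sub hnj.le]
  have hnj' : (n : ℝ) - j ≠ 0 := sub_ne_zero.2 (by exact_mod_cast hnj.ne')
  have h1 : 1 - (j : ℝ) / n = (n - j) / n := by field_simp
  have h2 : 1 - (j : ℝ) / n - r n / n = (n - (j + r n : ℕ)) / n := by
    push_cast
    field_simp
    ring
  rw [h2, h1, div_div_div_cancel_right₀ hn0.ne']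

lemma tendsto_choose_div_choose {r : ℕ → ℕ} {β : ℝ} (hβ : β < 1)
    (hr : Tendsto (fun n => (r n : ℝ) / n) atTop (nhds β)) (j : ℕ) :
    Tendsto (fun n => ((n - j).choose (r n) : ℝ) / n.choose (r n)) atTop
      (nhds ((1 - β) ^ j)) := by
  induction j with
  | zero =>
    have hlt : ∀ᶠ n : ℕ in atTop, (r n : ℝ) / n < 1 := hr.eventually_lt_const hβ
    refine (tendsto_const_nhds (x := (1 : ℝ))).congr' ?_ |>.trans (by simp)
    filter_upwards [hlt, eventually_gt_atTop 0] with n hn hn0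
    rw [div_lt_one (by exact_mod_cast hn0)] at hn
    have : 0 < n.choose (r n) := Nat.choose_pos (by exact_mod_cast hn.le)
    rw [Nat.sub_zero, div_self (by exact_mod_cast this.ne')]
  | succ j ih =>
    rw [pow_succ]
    refine (ih.mul (tendsto_sub_sub_div hβ hr j)).congr' ?_
    filter_upwards [eventually_gt_atTop j] with n hn
    have h := Nat.choose_mul_succ_eq (n - (j + 1)) (r n)
    rw [show n - (j + 1) + 1 = n - j by omega] at h
    have h' : ((n - (j + 1)).choose (r n) : ℝ) * (n - j : ℕ) =
        (n - j).choose (r n) * (n - j - r n : ℕ) := by exact_mod_cast h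
    have hpos : ((n - j : ℕ) : ℝ) ≠ 0 := by
      have : n - j ≠ 0 := by omega
      exact_mod_cast this
    rw [div_mul_div_comm, ← h', mul_div_mul_right _ _ hpos]

lemma tendsto_two_mul_floor_div {β : ℝ} (hβ : 0 ≤ β) :
    Tendsto (fun n : ℕ => ((2 * ⌊β * n / 2⌋₊ : ℕ) : ℝ) / n) atTop (nhds β) := by
  have h := ((tendsto_nat_floor_mul_div_atTop (R := ℝ) (a := β / 2) (by positivity)).comp
    tendsto_natCast_atTop_atTop).const_mul 2
  rw [mul_div_cancel₀ β two_ne_zero] at h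
  refine h.congr fun n => ?_
  simp only [Function.comp, Nat.cast_mul, Nat.cast_ofNat, mul_div_assoc, div_mul_eq_mul_div]

lemma tendsto_two_mul_floor_add_one_div {β : ℝ} (hβ : 0 ≤ β) :
    Tendsto (fun n : ℕ => ((2 * ⌊β * n / 2⌋₊ + 1 : ℕ) : ℝ) / n) atTop (nhds β) := by
  have h := (tendsto_two_mul_floor_div hβ).add (tendsto_const_div_atTop_nhds_zero_nat (1 : ℝ))
  rw [add_zero] at h
  refine h.congr fun n => ?_
  rw [Nat.cast_add, Nat.cast_one, add_div]

lemma le_liminf_of_tendsto_of_le {g u : ℕ → ℝ} {L C : ℝ} (hg : Tendsto g atTop (nhds L))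
    (hgu : ∀ᶠ n in atTop, g n ≤ u n) (hu : ∀ n, u n ≤ C) : L ≤ liminf u atTop := by
  rw [← hg.liminf_eq]
  exact liminf_le_liminf hgu hg.isBoundedUnder_ge
    (isBoundedUnder_of ⟨C, hu⟩ : IsBoundedUnder (· ≤ ·) atTop u).isCoboundedUnder_ge

/-- subcube lower bounds, Theorem 6: for `α = 2^{−k}` and `0 < β ≤ 1/2`,
asymptotic lower bounds `((1−β)/2)^k` for the sphere/ball noise stability problems. -/
theorem subcube_lower_bounds (k : ℕ) (hk : 1 ≤ k) (β : ℝ) (hβ1 : 0 < β) (hβ2 : β ≤ 1 / 2) :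
    ((1 - β) / 2) ^ k ≤
        liminf (fun n : ℕ => GammaS n (2 ^ (n - k)) (2 * ⌊β * n / 2⌋₊ + 1)) atTop ∧
    ((1 - β) / 2) ^ k ≤
        liminf (fun n : ℕ => GammaB n (2 ^ (n - k)) (2 * ⌊β * n / 2⌋₊)) atTop ∧
    (1 / 2) * ((1 - β) / 2) ^ (k - 1) ≤
        liminf (fun n : ℕ => GammaS n (2 ^ (n - k)) (2 * ⌊β * n / 2⌋₊)) atTop := by
  have hβ : β < 1 := by linarith
  have heven := tendsto_two_mul_floor_div hβ1.le
  have hodd := tendsto_two_mul_floor_add_one_div hβ1.le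
  have hpow : ((1 - β) / 2) ^ k = (1 / 2) ^ k * (1 - β) ^ k := by
    rw [← mul_pow]
    congr 1
    ring
  refine ⟨?_, ?_, ?_⟩
  · rw [hpow]
    refine le_liminf_of_tendsto_of_le ((tendsto_choose_div_choose hβ hodd k).const_mul _) ?_
      fun n => GammaS_le_one _ _ _
    filter_upwards [eventually_ge_atTop k] with n hn using le_GammaS_subcube hn _
  · rw [hpow]
    refine le_liminf_of_tendsto_of_le ((tendsto_choose_div_choose hβ heven k).const_mul _) ?_
      fun n => GammaB_le_one _ _ _
    filter_upwards [eventually_ge_atTop k] with n hn using le_GammaB_subcube hn _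
  · obtain ⟨j, rfl⟩ := Nat.exists_eq_add_of_le' hk
    rw [Nat.add_sub_cancel, show (1 / 2) * ((1 - β) / 2) ^ j = (1 / 2) ^ (j + 1) * (1 - β) ^ j by
      rw [pow_succ', mul_assoc, ← mul_pow]
      congr 2
      ring]
    refine le_liminf_of_tendsto_of_le ((tendsto_choose_div_choose hβ heven j).const_mul _) ?_
      fun n => GammaS_le_one _ _ _
    filter_upwards [eventually_gt_atTop j] with n hn using
      le_GammaS_evenSubcube hn (even_two_mul _)
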